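/- Let q be a prime power, t ≥ 1, K = F_{q^t}, m ≥ 1, and S = S_1 × ⋯ × S_m ⊆ K^m a Cartesian product of finite subsets with n_i = |S_i| and q^{t−1} ≤ n_j for a fixed index j. Let L_j = { a ∈ ℤ_{≥0}^m : n_j − q^{t−1} ≤ a_j ≤ n_j−1, a_i = n_i−1 for i ≠ j }, and let A ⊆ ∏_{i=1}^m {0,…,n_i−1} satisfy A ∩ L_j = ∅. Then for every f in the K-span of the monomials x^a with a ∈ A, and every integer b with 0 ≤ b ≤ q^{t−1} − 1, one has ∑_{s ∈ S} λ_s s_j^b f(s) = 0. -/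

import Mathlib

theorem sum_inv_prod_sub_mul_pow_eq_zero {K : Type*} [Field K] [DecidableEq K] (s : Finset K)
    {c : ℕ} (hc : c + 1 < s.card) :
    ∑ x ∈ s, (∏ u ∈ s.erase x, (x - u))⁻¹ * x ^ c = 0 := by
  have h := Lagrange.coeff_eq_sum (s := s) (v := id) (P := (Polynomial.X : Polynomial K) ^ c)
    Function.injective_id.injOn (by rw [Polynomial.degree_X_pow]; exact_mod_cast by omega)
  rw [Polynomial.coeff_X_pow, if_neg (by omega)] at h
  rw [h]
  exact Finset.sum_congr rfl fun x _ => by simp [div_eq_mul_inv, mul_comm]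


/-- Let `K = F_{q^t}`, `S = S_1 × ⋯ × S_m ⊆ K^m` with `n_i = |S_i|` and `q^{t−1} ≤ n_j`.
If `A ⊆ ∏_i {0,…,n_i−1}` avoids
`L_j = { a : n_j − q^{t−1} ≤ a_j ≤ n_j−1, a_i = n_i−1 for i ≠ j }`, then for every `f` in the
`K`-span of the monomial functions `x^a`, `a ∈ A`, and every `0 ≤ b ≤ q^{t−1} − 1`,
`∑_{s ∈ S} λ_s s_j^b f(s) = 0`. -/
theorem residue_monomial_orthogonal_code {K : Type*} [Field K] [Fintype K] [DecidableEq K]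
    {q t m : ℕ} (hq : IsPrimePow q) (ht : 1 ≤ t) (hK : Fintype.card K = q ^ t)
    (S : Fin m → Finset K) (hS : ∀ i, 1 ≤ (S i).card)
    (j : Fin m) (hj : q ^ (t - 1) ≤ (S j).card)
    (A : Set (Fin m → ℕ)) (hbox : ∀ a ∈ A, ∀ i, a i < (S i).card)
    (hAL : ∀ a ∈ A, ¬((S j).card - q ^ (t - 1) ≤ a j ∧ a j ≤ (S j).card - 1 ∧
        ∀ i, i ≠ j → a i = (S i).card - 1))
    (f : (Fin m → K) → K)
    (hf : f ∈ Submodule.span K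
        ((fun a : Fin m → ℕ => fun x : Fin m → K => ∏ i, x i ^ a i) '' A))
    (b : ℕ) (hb : b ≤ q ^ (t - 1) - 1) :
    ∑ s ∈ Fintype.piFinset S,
      (∏ i, ∏ u ∈ (S i).erase (s i), (s i - u))⁻¹ * s j ^ b * f s = 0 := by
  induction hf using Submodule.span_induction with
  | mem g hg =>
    obtain ⟨a, ha, rfl⟩ := hg
    have hfactor (s : Fin m → K) :
        (∏ i, ∏ u ∈ (S i).erase (s i), (s i - u))⁻¹ * s j ^ b * ∏ i, s i ^ a i =
          ∏ i, (∏ u ∈ (S i).erase (s i), (s i - u))⁻¹ *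
            s i ^ (a i + if i = j then b else 0) := by
      simp only [pow_add, Finset.prod_mul_distrib, Finset.prod_inv_distrib, pow_ite, pow_zero,
        Finset.prod_ite_eq', Finset.mem_univ, if_true]
      ring
    simp only [hfactor]
    rw [← Finset.prod_univ_sum S fun i x =>
      (∏ u ∈ (S i).erase x, (x - u))⁻¹ * x ^ (a i + if i = j then b else 0)]
    have hlow : ∃ i, a i + (if i = j then b else 0) + 1 < (S i).card := by
      have hpos : 0 < q ^ (t - 1) := pow_pos hq.pos _
      by_cases hc : a j < (S j).card - q ^ (t - 1)
      · exact ⟨j, by rw [if_pos rfl]; omega⟩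
      · have hbj := hbox a ha j
        have hne : ¬∀ i, i ≠ j → a i = (S i).card - 1 := fun h =>
          hAL a ha ⟨by omega, by omega, h⟩
        push Not at hne
        obtain ⟨i, hij, hi⟩ := hne
        have hbi := hbox a ha i
        exact ⟨i, by rw [if_neg hij]; omega⟩
    obtain ⟨i, hi⟩ := hlow
    exact Finset.prod_eq_zero (Finset.mem_univ i) (sum_inv_prod_sub_mul_pow_eq_zero (S i) hi)
  | zero => simp
  | add g h _ _ hg hh => simp only [Pi.add_apply, mul_add, Finset.sum_add_distrib, hg, hh, add_zero]
  | smul c g _ hg =>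
    simp only [Pi.smul_apply, smul_eq_mul, mul_left_comm _ c, ← Finset.mul_sum, hg, mul_zero]
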